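/- Let n, ν₊, ν₋ be natural numbers with ν₊ + ν₋ < n, and let G be a tournament graph on n vertices that is (ν₊, ν₋)-ambiguous with respect to a ground-truth ordering σ. Then for any two vertices x of order i and y of order j with i < j, either d_in(x) > d_in(y), or d_in(x) = d_in(y) and d_out(x) < d_out(y). In particular, sorting the vertices by decreasing simple in-degree, breaking ties by increasing simple out-degree, recovers the ground-truth ordering. -/

import Mathlib

/-- A tournament graph on `n` vertices: a directed graph without self-loops in which,
for every pair of distinct vertices, at least one of the two directed edges is present
(possibly both). -/
def IsTournament {n : ℕ} (E : Fin n → Fin n → Bool) : Prop :=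
  (∀ x, ¬ E x x) ∧ (∀ x y : Fin n, x ≠ y → E x y ∨ E y x)

/-- The edge `(x, y)` is simple: it is present and the reverse edge is absent. -/
def IsSimple {n : ℕ} (E : Fin n → Fin n → Bool) (x y : Fin n) : Prop :=
  E x y ∧ ¬ E y x

/-- The pair `{x, y}` forms a two-cycle: both directed edges are present. -/
def IsTwoCycle {n : ℕ} (E : Fin n → Fin n → Bool) (x y : Fin n) : Prop :=
  E x y ∧ E y x

instance {n : ℕ} (E : Fin n → Fin n → Bool) (x y : Fin n) :
    Decidable (IsTwoCycle E x y) :=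
  inferInstanceAs (Decidable (_ ∧ _))

instance {n : ℕ} (E : Fin n → Fin n → Bool) (x y : Fin n) :
    Decidable (IsSimple E x y) :=
  inferInstanceAs (Decidable (_ ∧ _))

/-- Simple in-degree: the number of simple edges pointing into `x`. -/
def dIn {n : ℕ} (E : Fin n → Fin n → Bool) (x : Fin n) : ℕ :=
  (Finset.univ.filter fun y => IsSimple E y x).card

/-- Simple out-degree: the number of simple edges pointing out of `x`. -/
def dOut {n : ℕ} (E : Fin n → Fin n → Bool) (x : Fin n) : ℕ :=
  (Finset.univ.filter fun y => IsSimple E x y).card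

/-- A tournament graph is `(ν₁, ν₂)`-ambiguous with respect to a ground-truth ordering `σ`
(where the vertex `x` has order `(σ x : ℕ) + 1 ∈ {1, …, n}`, i.e. `σ` is 0-indexed):
(1) every simple edge points in the correct direction (from larger to smaller order), and
(2) the vertex of order `i` has exactly `min (i-1) ν₁` two-cycles with vertices of smaller
order and exactly `min (n-i) ν₂` two-cycles with vertices of larger order. -/
def IsAmbiguous {n : ℕ} (ν₁ ν₂ : ℕ) (E : Fin n → Fin n → Bool)
    (σ : Equiv.Perm (Fin n)) : Prop :=
  (∀ x y : Fin n, IsSimple E x y → σ y < σ x) ∧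
  (∀ x : Fin n,
    (Finset.univ.filter fun y => σ y < σ x ∧ IsTwoCycle E x y).card
      = min (σ x : ℕ) ν₁) ∧
  (∀ x : Fin n,
    (Finset.univ.filter fun y => σ x < σ y ∧ IsTwoCycle E x y).card
      = min (n - 1 - (σ x : ℕ)) ν₂)

/-- The simple in-neighbours and the two-cycles with larger vertices partition the larger
vertices. -/
theorem IsAmbiguous.dIn_add_min {n ν₁ ν₂ : ℕ} {E : Fin n → Fin n → Bool}
    {σ : Equiv.Perm (Fin n)} (hT : IsTournament E) (h : IsAmbiguous ν₁ ν₂ E σ) (x : Fin n) :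
    dIn E x + min (n - 1 - (σ x : ℕ)) ν₂ = n - 1 - (σ x : ℕ) := by
  have hcard : (Finset.univ.filter fun y => σ x < σ y).card = n - 1 - (σ x : ℕ) := by
    rw [← Fin.card_Ioi, ← Finset.card_map σ.toEmbedding]
    congr 1
    ext z
    simp
  rw [← h.2.2 x, ← hcard, dIn, ← Finset.card_union_of_disjoint]
  · congr 1
    ext y
    have hsimple := h.1 y x
    have htotal := hT.2 x y
    have hsimple' := h.1 x y
    simp only [Finset.mem_union, Finset.mem_filter, Finset.mem_univ, true_and]
    unfold IsSimple IsTwoCycle at *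
    refine ⟨by tauto, fun hlt => ?_⟩
    have hne : x ≠ y := by rintro rfl; exact hlt.false
    have hnot := hlt.not_gt
    tauto
  · rw [Finset.disjoint_filter]
    exact fun y _ hs ht => hs.2 ht.2.1

/-- The simple out-neighbours and the two-cycles with smaller vertices partition the smaller
vertices. -/
theorem IsAmbiguous.dOut_add_min {n ν₁ ν₂ : ℕ} {E : Fin n → Fin n → Bool}
    {σ : Equiv.Perm (Fin n)} (hT : IsTournament E) (h : IsAmbiguous ν₁ ν₂ E σ) (x : Fin n) :
    dOut E x + min (σ x : ℕ) ν₁ = (σ x : ℕ) := by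
  have hcard : (Finset.univ.filter fun y => σ y < σ x).card = (σ x : ℕ) := by
    rw [← Fin.card_Iio, ← Finset.card_map σ.toEmbedding]
    congr 1
    ext z
    simp
  rw [← h.2.1 x, dOut, ← Finset.card_union_of_disjoint]
  · refine Eq.trans ?_ hcard
    congr 1
    ext y
    have hsimple := h.1 y x
    have htotal := hT.2 x y
    have hsimple' := h.1 x y
    simp only [Finset.mem_union, Finset.mem_filter, Finset.mem_univ, true_and]
    unfold IsSimple IsTwoCycle at *
    refine ⟨by tauto, fun hlt => ?_⟩
    have hne : x ≠ y := by rintro rfl; exact hlt.false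
    have hnot := hlt.not_gt
    tauto
  · rw [Finset.disjoint_filter]
    exact fun y _ hs ht => hs.2 ht.2.2

/-- In a `(ν₊, ν₋)`-ambiguous tournament graph with `ν₊ + ν₋ < n`,
for vertices `x` of order `i` and `y` of order `j` with `i < j`, either
`dIn x > dIn y`, or `dIn x = dIn y` and `dOut x < dOut y`. -/
theorem ambiguous_degree_sort {n ν₁ ν₂ : ℕ} (hν : ν₁ + ν₂ < n)
    (E : Fin n → Fin n → Bool) (hT : IsTournament E)
    (σ : Equiv.Perm (Fin n)) (h : IsAmbiguous ν₁ ν₂ E σ)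
    (x y : Fin n) (hxy : σ x < σ y) :
    dIn E y < dIn E x ∨ (dIn E x = dIn E y ∧ dOut E x < dOut E y) := by
  have hix := h.dIn_add_min hT x
  have hiy := h.dIn_add_min hT y
  have hox := h.dOut_add_min hT x
  have hoy := h.dOut_add_min hT y
  have hlt : (σ x : ℕ) < σ y := hxy
  have hy := (σ y).isLt
  omega
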